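/- Every ℝ-linear isometric automorphism of ℍ of determinant 1 (i.e., every element of SO(4,ℝ) acting on ℍ ≅ ℝ⁴) is of the form q ↦ a * q * b for some unit quaternions a and b. -/

import Mathlib

open Quaternion

/-- The reflection of `ℍ` in the hyperplane orthogonal to a unit quaternion `u` is
`q ↦ -(u * star q * u)`. -/
theorem Quaternion.reflection_orthogonal_singleton_apply {u : ℍ[ℝ]} (hu : ‖u‖ = 1) (q : ℍ[ℝ]) :
    (ℝ ∙ u)ᗮ.reflection q = -(u * star q * u) := by
  have hn : u.re ^ 2 + u.imI ^ 2 + u.imJ ^ 2 + u.imK ^ 2 = 1 := by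
    rw [← Quaternion.normSq_def', Quaternion.normSq_eq_norm_mul_self, hu, mul_one]
  rw [Submodule.reflection_orthogonal_apply, Submodule.reflection_singleton_apply,
    Quaternion.inner_def, hu, two_smul]
  congr 1
  ext <;> simp
  · linear_combination q.re * hn
  · linear_combination q.imI * hn
  · linear_combination q.imJ * hn
  · linear_combination q.imK * hn

/-- A hyperplane reflection has determinant `-1`. -/
theorem Submodule.det_reflection_orthogonal_singleton {E : Type*} [NormedAddCommGroup E]
    [InnerProductSpace ℝ E] [FiniteDimensional ℝ E] {v : E} (hv : v ≠ 0) :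
    LinearMap.det ((ℝ ∙ v)ᗮ.reflection.toLinearEquiv : E →ₗ[ℝ] E) = -1 := by
  have h := Submodule.det_reflection (K := (ℝ ∙ v)ᗮ)
  rw [Submodule.orthogonal_orthogonal, finrank_span_singleton hv, pow_one] at h
  exact h

/-- A product of hyperplane reflections of `ℍ` is `q ↦ a * q * b` or `q ↦ a * star q * b` with
`a`, `b` unit quaternions, according to the sign of its determinant. -/
theorem Quaternion.prod_reflections_eq (l : List ℍ[ℝ]) :
    ∃ a b : ℍ[ℝ], ‖a‖ = 1 ∧ ‖b‖ = 1 ∧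
      ((LinearMap.det ((l.map fun v => (ℝ ∙ v)ᗮ.reflection).prod.toLinearEquiv :
          ℍ[ℝ] →ₗ[ℝ] ℍ[ℝ]) = 1 ∧
        ∀ q, (l.map fun v => (ℝ ∙ v)ᗮ.reflection).prod q = a * q * b) ∨
      (LinearMap.det ((l.map fun v => (ℝ ∙ v)ᗮ.reflection).prod.toLinearEquiv :
          ℍ[ℝ] →ₗ[ℝ] ℍ[ℝ]) = -1 ∧
        ∀ q, (l.map fun v => (ℝ ∙ v)ᗮ.reflection).prod q = a * star q * b)) := by
  induction l with
  | nil => exact ⟨1, 1, norm_one, norm_one, .inl ⟨LinearMap.det_id, fun q => by simp⟩⟩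
  | cons v l ih =>
    obtain ⟨a, b, ha, hb, h⟩ := ih
    rw [List.map_cons, List.prod_cons]
    generalize (l.map fun v => (ℝ ∙ v)ᗮ.reflection).prod = g at h ⊢
    rcases eq_or_ne v 0 with rfl | hv
    · have h1 : (ℝ ∙ (0 : ℍ[ℝ]))ᗮ.reflection * g = g := by
        ext1 q
        rw [LinearIsometryEquiv.coe_mul, Function.comp_apply, Submodule.reflection_eq_self_iff,
          Submodule.mem_orthogonal_singleton_iff_inner_right, inner_zero_left]
      exact ⟨a, b, ha, hb, by rwa [h1]⟩
    · obtain ⟨u, hu, hspan⟩ : ∃ u : ℍ[ℝ], ‖u‖ = 1 ∧ (ℝ ∙ v) = (ℝ ∙ u) :=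
        ⟨‖v‖⁻¹ • v, norm_smul_inv_norm (𝕜 := ℝ) hv,
          (Submodule.span_singleton_smul_eq (by simpa using hv) v).symm⟩
      have hdet : LinearMap.det (((ℝ ∙ v)ᗮ.reflection * g).toLinearEquiv : ℍ[ℝ] →ₗ[ℝ] ℍ[ℝ]) =
          -LinearMap.det (g.toLinearEquiv : ℍ[ℝ] →ₗ[ℝ] ℍ[ℝ]) := by
        rw [← neg_one_mul, ← Submodule.det_reflection_orthogonal_singleton hv]
        exact LinearMap.det_comp _ _
      have happ (q : ℍ[ℝ]) : ((ℝ ∙ v)ᗮ.reflection * g) q = -(u * star (g q) * u) := by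
        rw [← Quaternion.reflection_orthogonal_singleton_apply hu]
        simp only [hspan, LinearIsometryEquiv.coe_mul, Function.comp_apply]
      refine ⟨-(u * star b), star a * u, by simp [hu, hb], by simp [hu, ha], ?_⟩
      rw [hdet]
      rcases h with ⟨hd, hg⟩ | ⟨hd, hg⟩
      · exact .inr ⟨by rw [hd], fun q => by rw [happ, hg]; simp [mul_assoc]⟩
      · exact .inl ⟨by rw [hd, neg_neg], fun q => by rw [happ, hg]; simp [mul_assoc]⟩

/-- Every ℝ-linear isometric automorphism of ℍ of determinant 1 (i.e. every element
of SO(4,ℝ) acting on ℍ ≅ ℝ⁴) has the form `q ↦ a * q * b` for unit quaternions `a, b`. -/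
theorem so4_eq_quaternion_rotation (f : ℍ[ℝ] ≃ₗᵢ[ℝ] ℍ[ℝ])
    (hdet : LinearMap.det (f.toLinearEquiv : ℍ[ℝ] →ₗ[ℝ] ℍ[ℝ]) = 1) :
    ∃ a b : ℍ[ℝ], ‖a‖ = 1 ∧ ‖b‖ = 1 ∧ ∀ q : ℍ[ℝ], f q = a * q * b := by
  obtain ⟨l, -, rfl⟩ := f.reflections_generate_dim
  obtain ⟨a, b, ha, hb, ⟨-, h⟩ | ⟨hd, -⟩⟩ := Quaternion.prod_reflections_eq l
  · exact ⟨a, b, ha, hb, h⟩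
  · rw [hd] at hdet
    norm_num at hdet
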